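/- arXiv:1306.1867 — 3 statements merged into one kernel-verified Lean document; each statement's English description precedes it below -/
import Mathlib

section
/- Let μ ∈ (0,1] and let g : [0,1] → ℝ be continuous on [0,1]. Suppose there is a function λ : (0,1] → ℝ such that for every τ ∈ (0,1] the restriction of g to the interval [τ,1] is Lipschitz continuous with constant λ(τ), and suppose there exist M ≥ 0 and δ ∈ (0,1] such that x^{1−μ}·λ(x) ≤ M for all x ∈ (0,δ] (i.e. lim sup_{x→0⁺} x^{1−μ}λ(x) < ∞). Then g is Hölder continuous of exponent μ on [0,1]: there exists a constant C ≥ 0 such that |g(x) − g(y)| ≤ C·|x−y|^μ for all x, y ∈ [0,1]. -/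
/-- If every forward chord of `g` from `x > 0` has slope at most `A * x ^ (μ - 1)`, then the
increments of `g` are dominated by those of `A / μ * x ^ μ`. -/
theorem sub_le_rpow_sub_rpow_of_forward_slope_le {μ A : ℝ} (hμ : 0 < μ) {g : ℝ → ℝ}
    (hg : ContinuousOn g (Set.Icc 0 1))
    (h : ∀ x y, 0 < x → x < y → y ≤ 1 → g y - g x ≤ A * x ^ (μ - 1) * (y - x))
    {x y : ℝ} (hx : 0 < x) (hxy : x ≤ y) (hy : y ≤ 1) :
    g y - g x ≤ A / μ * (y ^ μ - x ^ μ) := by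
  have key := image_le_of_liminf_slope_right_le_deriv_boundary (f := g) (a := x) (b := y)
    (B := fun t => A / μ * (t ^ μ - x ^ μ) + g x) (B' := fun t => A * t ^ (μ - 1))
    (hg.mono (Set.Icc_subset_Icc hx.le hy)) (by simp)
    (by
      have : Continuous fun t : ℝ => t ^ μ := Real.continuous_rpow_const hμ.le
      fun_prop)
    (fun t ht => by
      have ht0 : t ≠ 0 := (hx.trans_le ht.1).ne'
      have := ((((Real.hasDerivAt_rpow_const (p := μ) (Or.inl ht0)).sub_const
        (x ^ μ)).const_mul (A / μ)).add_const (g x)).hasDerivWithinAt (s := Set.Ici t)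
      rw [← mul_assoc, div_mul_cancel₀ _ hμ.ne'] at this
      exact this)
    (fun t ht r hr => by
      have ht0 : 0 < t := hx.trans_le ht.1
      refine Filter.Eventually.frequently ?_
      filter_upwards [Ioo_mem_nhdsGT ht.2] with z hz
      refine lt_of_le_of_lt ?_ hr
      rw [slope_def_field, div_le_iff₀ (sub_pos.2 hz.1)]
      exact h t z ht0 hz.1 (hz.2.le.trans hy))
    (Set.right_mem_Icc.2 hxy)
  linarith

/-- If every forward chord of `g` from `x > 0` has slope at most `A * x ^ (μ - 1)` in absolute
value, then `g` is Hölder continuous of exponent `μ` on `[0, 1]`. -/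
theorem abs_sub_le_rpow_of_forward_slope_le {μ A : ℝ} (hμ : μ ∈ Set.Ioc (0 : ℝ) 1) (hA : 0 ≤ A)
    {g : ℝ → ℝ} (hg : ContinuousOn g (Set.Icc 0 1))
    (h : ∀ x y, 0 < x → x < y → y ≤ 1 → |g y - g x| ≤ A * x ^ (μ - 1) * (y - x))
    {x y : ℝ} (hx : 0 ≤ x) (hxy : x ≤ y) (hy : y ≤ 1) :
    |g y - g x| ≤ A / μ * (y - x) ^ μ := by
  have hAμ : 0 ≤ A / μ := div_nonneg hA hμ.1.le
  have pos : ∀ t, 0 < t → t ≤ y → |g y - g t| ≤ A / μ * (y - t) ^ μ := by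
    intro t ht hty
    have h₁ := sub_le_rpow_sub_rpow_of_forward_slope_le hμ.1 hg
      (fun a b ha hab hb => (le_abs_self _).trans (h a b ha hab hb)) ht hty hy
    have h₂ := sub_le_rpow_sub_rpow_of_forward_slope_le (A := A) (g := fun s => -g s)
      hμ.1 hg.neg
      (fun a b ha hab hb => by
        have := (neg_le_abs _).trans (h a b ha hab hb)
        linarith) ht hty hy
    have h₃ : y ^ μ - t ^ μ ≤ (y - t) ^ μ := by
      have := Real.rpow_add_le_add_rpow (sub_nonneg.2 hty) ht.le hμ.1.le hμ.2
      rw [sub_add_cancel] at this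
      linarith
    have h₄ := mul_le_mul_of_nonneg_left h₃ hAμ
    exact abs_le.2 ⟨by linarith, by linarith⟩
  rcases hx.eq_or_lt with rfl | hx
  · rcases hxy.eq_or_lt with rfl | hy0
    · simp [Real.zero_rpow hμ.1.ne']
    have hg0 : Filter.Tendsto g (nhdsWithin 0 (Set.Ioi 0)) (nhds (g 0)) :=
      (hg 0 (by simp)).mono_of_mem_nhdsWithin (Icc_mem_nhdsGT zero_lt_one)
    have hpow : Continuous fun t : ℝ => A / μ * (y - t) ^ μ :=
      continuous_const.mul ((Real.continuous_rpow_const hμ.1.le).comp (by fun_prop))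
    refine le_of_tendsto_of_tendsto (tendsto_const_nhds.sub hg0).abs
      (hpow.continuousWithinAt (s := Set.Ioi 0) (x := 0)) ?_
    filter_upwards [Ioo_mem_nhdsGT hy0] with t ht
    exact pos t ht.1 ht.2.le
  · exact pos x hx hxy

/-- Lemma 4.1: if `g` is continuous on `[0,1]`, Lipschitz with constant `lam τ` on each
`[τ,1]`, and `x^(1-μ) * lam x` stays bounded near `0`, then `g` is `μ`-Hölder on `[0,1]`. -/
theorem stmt0 (μ : ℝ) (hμ : μ ∈ Set.Ioc (0:ℝ) 1) (g : ℝ → ℝ)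
    (hg : ContinuousOn g (Set.Icc 0 1))
    (lam : ℝ → ℝ)
    (hlip : ∀ τ ∈ Set.Ioc (0:ℝ) 1, ∀ x ∈ Set.Icc τ 1, ∀ y ∈ Set.Icc τ 1,
      |g x - g y| ≤ lam τ * |x - y|)
    (M δ : ℝ) (hM : 0 ≤ M) (hδ : δ ∈ Set.Ioc (0:ℝ) 1)
    (hbound : ∀ x ∈ Set.Ioc (0:ℝ) δ, x ^ (1 - μ) * lam x ≤ M) :
    ∃ C : ℝ, 0 ≤ C ∧ ∀ x ∈ Set.Icc (0:ℝ) 1, ∀ y ∈ Set.Icc (0:ℝ) 1,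
      |g x - g y| ≤ C * |x - y| ^ μ := by
  have hA : 0 ≤ max M |lam δ| := hM.trans (le_max_left _ _)
  have slope : ∀ x y, 0 < x → x < y → y ≤ 1 →
      |g y - g x| ≤ max M |lam δ| * x ^ (μ - 1) * (y - x) := by
    intro x y hx hxy hy
    rcases le_total x δ with hxδ | hxδ
    · have hlam : lam x ≤ M * x ^ (μ - 1) := by
        have hp : 0 < x ^ (1 - μ) := Real.rpow_pos_of_pos hx _
        rw [← neg_sub 1 μ, Real.rpow_neg hx.le, ← div_eq_mul_inv, le_div_iff₀ hp, mul_comm]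
        exact hbound x ⟨hx, hxδ⟩
      have hl := hlip x ⟨hx, hxy.le.trans hy⟩ y ⟨hxy.le, hy⟩ x ⟨le_rfl, hxy.le.trans hy⟩
      rw [abs_of_pos (sub_pos.2 hxy)] at hl
      refine hl.trans (mul_le_mul_of_nonneg_right (hlam.trans ?_) (sub_pos.2 hxy).le)
      gcongr
      exact le_max_left _ _
    · have hl := hlip δ hδ y ⟨hxδ.trans hxy.le, hy⟩ x ⟨hxδ, hxy.le.trans hy⟩
      rw [abs_of_pos (sub_pos.2 hxy)] at hl
      refine hl.trans (mul_le_mul_of_nonneg_right ?_ (sub_pos.2 hxy).le)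
      have hone : 1 ≤ x ^ (μ - 1) :=
        Real.one_le_rpow_of_pos_of_le_one_of_nonpos hx (hxy.le.trans hy) (by linarith [hμ.2])
      exact ((le_abs_self _).trans (le_max_right _ _)).trans (le_mul_of_one_le_right hA hone)
  refine ⟨max M |lam δ| / μ, div_nonneg hA hμ.1.le, fun x hx y hy => ?_⟩
  rcases le_total x y with hxy | hxy
  · rw [abs_sub_comm, abs_sub_comm x, abs_of_nonneg (sub_nonneg.2 hxy)]
    exact abs_sub_le_rpow_of_forward_slope_le hμ hA hg slope hx.1 hxy hy.2
  · rw [abs_of_nonneg (sub_nonneg.2 hxy)]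
    exact abs_sub_le_rpow_of_forward_slope_le hμ hA hg slope hy.1 hxy hx.2
end

section
/- Let μ ∈ (0,1], let g : ℝ → ℝ be continuous on the half-open interval (0,1], and let C : (0,1] → ℝ be a nonnegative antitone function (i.e. C(σ) ≥ C(τ) whenever 0 < σ ≤ τ ≤ 1). Suppose that for every τ ∈ (0,1] and all x, y ∈ [τ,1] one has |g(x) − g(y)| ≤ C(τ)·|x−y|^μ, and suppose that the function t ↦ t^{μ−1}·C(t) is integrable on the interval (0,1). Then g is bounded on (0,1]: there exists M ≥ 0 such that |g(x)| ≤ M for all x ∈ (0,1]. -/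
open MeasureTheory in
/-- A dyadic block of a weighted integral of a nonincreasing function controls its endpoint value. -/
theorem mul_rpow_le_two_mul_intervalIntegral {μ : ℝ} (hμ : μ ≤ 1) {C : ℝ → ℝ} {x : ℝ} (hx : 0 < x)
    (hC0 : 0 ≤ C x) (hC : ∀ t, 0 < t → t ≤ x → C x ≤ C t)
    (hint : IntervalIntegrable (fun t : ℝ => t ^ (μ - 1) * C t) volume (x / 2) x) :
    C x * x ^ μ ≤ 2 * ∫ t in (x / 2)..x, t ^ (μ - 1) * C t := by
  have key : (∫ _ in (x / 2)..x, x ^ (μ - 1) * C x) ≤ ∫ t in (x / 2)..x, t ^ (μ - 1) * C t := by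
    refine intervalIntegral.integral_mono_on (by linarith) intervalIntegrable_const hint
      fun t ht => ?_
    have ht0 : 0 < t := lt_of_lt_of_le (by linarith) ht.1
    exact mul_le_mul (Real.rpow_le_rpow_of_nonpos ht0 ht.2 (by linarith)) (hC t ht0 ht.2) hC0
      (by positivity)
  rw [intervalIntegral.integral_const, smul_eq_mul] at key
  have hpow : x * x ^ (μ - 1) = x ^ μ := by
    rw [Real.rpow_sub_one hx.ne', mul_div_cancel₀ _ hx.ne']
  calc C x * x ^ μ = 2 * ((x - x / 2) * (x ^ (μ - 1) * C x)) := by rw [← hpow]; ring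
    _ ≤ _ := by gcongr


/-- First part of Lemma 3.7: if `g` is `μ`-Hölder with constant `C τ` on each `[τ,1]`,
`C` is nonnegative and antitone, and `t ↦ t^(μ-1) * C t` is integrable on `(0,1)`, then
`g` is bounded on `(0,1]`. -/
theorem stmt1 (μ : ℝ) (hμ : μ ∈ Set.Ioc (0:ℝ) 1) (g : ℝ → ℝ)
    (hg : ContinuousOn g (Set.Ioc 0 1))
    (C : ℝ → ℝ)
    (hC0 : ∀ τ ∈ Set.Ioc (0:ℝ) 1, 0 ≤ C τ)
    (hCanti : ∀ σ τ : ℝ, 0 < σ → σ ≤ τ → τ ≤ 1 → C τ ≤ C σ)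
    (hhold : ∀ τ ∈ Set.Ioc (0:ℝ) 1, ∀ x ∈ Set.Icc τ 1, ∀ y ∈ Set.Icc τ 1,
      |g x - g y| ≤ C τ * |x - y| ^ μ)
    (hint : MeasureTheory.IntegrableOn (fun t : ℝ => t ^ (μ - 1) * C t) (Set.Ioo 0 1)) :
    ∃ M : ℝ, 0 ≤ M ∧ ∀ x ∈ Set.Ioc (0:ℝ) 1, |g x| ≤ M := by
  set f : ℝ → ℝ := fun t => t ^ (μ - 1) * C t
  have hf0 : ∀ t ∈ Set.Ioc (0 : ℝ) 1, 0 ≤ f t := fun t ht =>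
    mul_nonneg (Real.rpow_nonneg ht.1.le _) (hC0 t ht)
  have hI : ∀ a b : ℝ, 0 ≤ a → a ≤ b → b ≤ 1 → IntervalIntegrable f MeasureTheory.volume a b := by
    intro a b ha hab hb
    rw [intervalIntegrable_iff_integrableOn_Ioo_of_le hab]
    exact hint.mono_set (Set.Ioo_subset_Ioo ha hb)
  have hnn : ∀ a b : ℝ, 0 < a → a ≤ b → b ≤ 1 → 0 ≤ ∫ t in a..b, f t := fun a b ha hab hb =>
    intervalIntegral.integral_nonneg hab fun t ht =>
      hf0 t ⟨ha.trans_le ht.1, ht.2.trans hb⟩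
  have hstep : ∀ x y : ℝ, 0 < x → x ≤ y → y ≤ 1 → y ≤ 2 * x →
      |g x| ≤ |g y| + 2 * ∫ t in (x / 2)..x, f t := by
    intro x y hx hxy hy hyx
    have hx1 : x ∈ Set.Ioc (0 : ℝ) 1 := ⟨hx, hxy.trans hy⟩
    have hle := hhold x hx1 x ⟨le_rfl, hx1.2⟩ y ⟨hxy, hy⟩
    have hpow : |x - y| ^ μ ≤ x ^ μ :=
      Real.rpow_le_rpow (abs_nonneg _) (abs_le.2 ⟨by linarith, by linarith⟩) hμ.1.le
    have hblock := mul_rpow_le_two_mul_intervalIntegral hμ.2 hx (hC0 x hx1)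
      (fun t ht htx => hCanti t x ht htx hx1.2) (hI (x / 2) x (by linarith) (by linarith) hx1.2)
    have htri := abs_sub_abs_le_abs_sub (g x) (g y)
    have := mul_le_mul_of_nonneg_left hpow (hC0 x hx1)
    linarith
  have hsplit : ∀ a b : ℝ, 0 ≤ a → a ≤ b → b ≤ 1 →
      (∫ t in a..b, f t) + ∫ t in b..1, f t = ∫ t in a..1, f t := fun a b ha hab hb =>
    intervalIntegral.integral_add_adjacent_intervals (hI a b ha hab hb)
      (hI b 1 (ha.trans hab) hb le_rfl)
  have hdyadic : ∀ (n : ℕ) (x : ℝ), 0 < x → x ≤ 1 → 1 ≤ 2 ^ n * x →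
      |g x| ≤ |g 1| + 2 * ∫ t in (x / 2)..1, f t := by
    intro n
    induction n with
    | zero =>
      intro x hx hx1 hn
      obtain rfl : x = 1 := le_antisymm hx1 (by simpa using hn)
      have := hnn (1 / 2) 1 (by norm_num) (by norm_num) le_rfl
      linarith
    | succ n ih =>
      intro x hx hx1 hn
      have hs := hsplit (x / 2) x (by linarith) (by linarith) hx1
      rcases le_total (2 * x) 1 with h | h
      · have h2 := ih (2 * x) (by linarith) h (by rw [pow_succ] at hn; linarith)
        rw [mul_div_cancel_left₀ x two_ne_zero] at h2
        have := hstep x (2 * x) hx (by linarith) h le_rfl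
        linarith
      · have := hstep x 1 hx hx1 le_rfl h
        have := hnn x 1 hx hx1 le_rfl
        linarith
  have hnn0 : ∀ b : ℝ, 0 ≤ b → b ≤ 1 → 0 ≤ ∫ t in (0 : ℝ)..b, f t := by
    intro b hb hb1
    rw [intervalIntegral.integral_of_le hb]
    exact MeasureTheory.setIntegral_nonneg measurableSet_Ioc fun t ht =>
      hf0 t ⟨ht.1, ht.2.trans hb1⟩
  refine ⟨|g 1| + 2 * ∫ t in (0 : ℝ)..1, f t, ?_, fun x hx => ?_⟩
  · have := hnn0 1 zero_le_one le_rfl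
    positivity
  · obtain ⟨n, hn⟩ := pow_unbounded_of_one_lt x⁻¹ (one_lt_two (α := ℝ))
    have hb := hdyadic n x hx.1 hx.2 ((inv_lt_iff_one_lt_mul₀ hx.1).1 hn).le
    have h0 := hnn0 (x / 2) (by linarith [hx.1]) (by linarith [hx.1, hx.2])
    have hs := hsplit 0 (x / 2) le_rfl (by linarith [hx.1]) (by linarith [hx.1, hx.2])
    linarith
end

section
/- Let m ≥ 2 and let b : Fin m → ℝ satisfy b(i) > 0 for every i. Then ∑_{i} 1/b(i) ≥ ( (∑_{i} b(i)) / (∏_{i} b(i)) )^{1/(m−1)}, where the right-hand side uses the real power with exponent 1/(m−1). -/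
theorem Finset.sum_div_prod_le_sum_inv_pow {ι : Type*} {s : Finset ι} (hs : s.Nonempty)
    (b : ι → ℝ) (hb : ∀ i ∈ s, 0 < b i) :
    (∑ i ∈ s, b i) / ∏ i ∈ s, b i ≤ (∑ i ∈ s, (b i)⁻¹) ^ (s.card - 1) := by
  induction hs using Finset.Nonempty.cons_induction with
  | singleton a =>
    have ha := (hb a (by simp)).ne'
    simp [ha]
  | cons c s hc hs ih =>
    have hbc : 0 < b c := hb c (by simp)
    have hbs : ∀ i ∈ s, 0 < b i := fun i hi => hb i (by simp [hi])
    have hprod : 0 < ∏ i ∈ s, b i := Finset.prod_pos hbs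
    have hinv : ∀ i ∈ s, 0 ≤ (b i)⁻¹ := fun i hi => (inv_pos.2 (hbs i hi)).le
    have hle : (∏ i ∈ s, b i)⁻¹ ≤ (∑ i ∈ s, (b i)⁻¹) ^ s.card := by
      rw [← Finset.prod_inv_distrib, ← Finset.prod_const]
      exact Finset.prod_le_prod hinv fun i hi => Finset.single_le_sum hinv hi
    obtain ⟨k, hk⟩ := Nat.exists_eq_succ_of_ne_zero hs.card_pos.ne'
    have ih := ih hbs
    simp only [Finset.sum_cons, Finset.prod_cons, Finset.card_cons, hk, Nat.succ_eq_add_one,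
      Nat.add_sub_cancel] at hle ih ⊢
    set S := ∑ i ∈ s, (b i)⁻¹
    have hS : 0 ≤ S := Finset.sum_nonneg hinv
    have hc' : 0 ≤ (b c)⁻¹ := (inv_pos.2 hbc).le
    calc (b c + ∑ i ∈ s, b i) / (b c * ∏ i ∈ s, b i)
        = (∏ i ∈ s, b i)⁻¹ + (b c)⁻¹ * ((∑ i ∈ s, b i) / ∏ i ∈ s, b i) := by
          field_simp
      _ ≤ S ^ (k + 1) + (b c)⁻¹ * S ^ k := by gcongr
      _ = S ^ k * ((b c)⁻¹ + S) := by ring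
      _ ≤ ((b c)⁻¹ + S) ^ k * ((b c)⁻¹ + S) := by
          gcongr
          exact le_add_of_nonneg_left hc'
      _ = ((b c)⁻¹ + S) ^ (k + 1) := (pow_succ _ _).symm

/-- Yau-type inequality (cf. 2.19 in Yau): for positive reals `b i`,
`∑ 1/bᵢ ≥ ((∑ bᵢ)/(∏ bᵢ))^(1/(m-1))`. -/
theorem stmt4 (m : ℕ) (hm : 2 ≤ m) (b : Fin m → ℝ) (hb : ∀ i, 0 < b i) :
    ∑ i, 1 / b i ≥ ((∑ i, b i) / ∏ i, b i) ^ (1 / ((m : ℝ) - 1)) := by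
  have : NeZero m := ⟨by omega⟩
  have h := Finset.sum_div_prod_le_sum_inv_pow Finset.univ_nonempty b fun i _ => hb i
  have hsum : 0 ≤ ∑ i, b i := Finset.sum_nonneg fun i _ => (hb i).le
  have hprod : 0 ≤ ∏ i, b i := Finset.prod_nonneg fun i _ => (hb i).le
  have hinv : 0 ≤ ∑ i, (b i)⁻¹ := Finset.sum_nonneg fun i _ => (inv_pos.2 (hb i)).le
  have hcast : (m : ℝ) - 1 = ((m - 1 : ℕ) : ℝ) := by
    rw [Nat.cast_sub (by omega), Nat.cast_one]
  rw [Finset.card_fin] at h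
  simp only [one_div, ge_iff_le, hcast]
  calc ((∑ i, b i) / ∏ i, b i) ^ (((m - 1 : ℕ) : ℝ)⁻¹)
      ≤ ((∑ i, (b i)⁻¹) ^ (m - 1)) ^ (((m - 1 : ℕ) : ℝ)⁻¹) :=
        Real.rpow_le_rpow (div_nonneg hsum hprod) h (by positivity)
    _ = ∑ i, (b i)⁻¹ := Real.pow_rpow_inv_natCast hinv (by omega)
end
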